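/- arXiv:1208.6385 — 2 statements merged into one kernel-verified Lean document; each statement's English description precedes it below -/
import Mathlib

section
/- A global vector u satisfies K u = f if and only if there exists a family of local nodal traction vectors λ^(s) (each λ^(s) a vector on D^(s)) such that: (a) λ^(s)_d = 0 for every interior degree of freedom d of subdomain s; (b) for every s, K^(s) (P^(s) u) = f^(s) + λ^(s); and (c) Σ_s (P^(s))ᵀ λ^(s) = 0. -/
open Matrix

/-- At an interior degree of freedom, an assembled vector reduces to the single local entry. -/
lemma sum_transpose_mulVec_apply_of_interior
    {S N : Type*} [Fintype S] {D : S → Type*} [∀ s, Fintype (D s)] [DecidableEq N]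
    (ι : ∀ s, D s → N) (lam : ∀ s, D s → ℝ) (s : S) (hs : Function.Injective (ι s)) (d : D s)
    (hd : ∀ s', s' ≠ s → ι s d ∉ Set.range (ι s')) :
    (∑ s', (Matrix.of fun e n => if ι s' e = n then (1 : ℝ) else 0)ᵀ.mulVec (lam s')) (ι s d) =
      lam s d := by
  rw [Finset.sum_apply, Finset.sum_eq_single s]
  · simp only [mulVec, dotProduct, transpose_apply, of_apply]
    rw [Finset.sum_eq_single d]
    · simp
    · intro e _ he
      simp [hs.ne he]
    · simp
  · intro s' _ hs'
    simp only [mulVec, dotProduct, transpose_apply, of_apply]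
    refine Finset.sum_eq_zero fun e _ => ?_
    rw [if_neg fun h => hd s' hs' ⟨e, h⟩, zero_mul]
  · simp

/-- For the assembled stiffness `K = Σ_s (P^(s))ᵀ K^(s) P^(s)` and
load `f = Σ_s (P^(s))ᵀ f^(s)`, a global vector `u` satisfies `K u = f` iff there
exists a family of local nodal traction vectors `λ^(s)` such that
(a) `λ^(s)_d = 0` for every interior dof `d` of subdomain `s`;
(b) `K^(s) (P^(s) u) = f^(s) + λ^(s)` for every `s`; and
(c) `Σ_s (P^(s))ᵀ λ^(s) = 0`. -/
theorem substructured_equilibrium_characterization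
    {N : ℕ} {nsd : ℕ} {D : Fin nsd → ℕ}
    (ι : ∀ s : Fin nsd, Fin (D s) → Fin N)
    (hι : ∀ s, Function.Injective (ι s))
    (P : ∀ s : Fin nsd, Matrix (Fin (D s)) (Fin N) ℝ)
    (hP : ∀ s, P s = Matrix.of fun d n => if ι s d = n then (1 : ℝ) else 0)
    (Kloc : ∀ s : Fin nsd, Matrix (Fin (D s)) (Fin (D s)) ℝ)
    (floc : ∀ s : Fin nsd, Fin (D s) → ℝ)
    (K : Matrix (Fin N) (Fin N) ℝ)
    (hK : K = ∑ s, (P s)ᵀ * Kloc s * P s)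
    (f : Fin N → ℝ)
    (hf : f = ∑ s, (P s)ᵀ.mulVec (floc s))
    (u : Fin N → ℝ) :
    K.mulVec u = f ↔
      ∃ lam : ∀ s : Fin nsd, Fin (D s) → ℝ,
        (∀ s, ∀ d : Fin (D s),
          (∀ s', s' ≠ s → ι s d ∉ Set.range (ι s')) → lam s d = 0) ∧
        (∀ s, (Kloc s).mulVec ((P s).mulVec u) = floc s + lam s) ∧
        (∑ s, (P s)ᵀ.mulVec (lam s)) = 0 := by
  have hKu : K.mulVec u = ∑ s, (P s)ᵀ.mulVec ((Kloc s).mulVec ((P s).mulVec u)) := by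
    simp only [hK, sum_mulVec, mulVec_mulVec, Matrix.mul_assoc]
  constructor
  · intro h
    have hsum : ∑ s, (P s)ᵀ.mulVec ((Kloc s).mulVec ((P s).mulVec u) - floc s) = 0 := by
      simp only [mulVec_sub, Finset.sum_sub_distrib]
      rw [← hKu, ← hf, h, sub_self]
    refine ⟨fun s => (Kloc s).mulVec ((P s).mulVec u) - floc s, fun s d hd => ?_,
      fun s => (add_sub_cancel _ _).symm, hsum⟩
    refine (sum_transpose_mulVec_apply_of_interior ι
      (fun s => (Kloc s).mulVec ((P s).mulVec u) - floc s) s (hι s) d hd).symm.trans ?_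
    simp only [← hP]
    rw [hsum, Pi.zero_apply]
  · rintro ⟨lam, -, hloc, hsum⟩
    rw [hKu, hf]
    simp only [hloc, mulVec_add, Finset.sum_add_distrib]
    rw [hsum, add_zero]
end

section
/- Assume for each s that S^(s) is symmetric and S^(s) R_b^(s) = 0. Let u_b be a global interface vector, set λ_b^(s) = S^(s) (A^(s))ᵀ u_b − b^(s), let r = Σ_s A^(s) λ_b^(s) be the assembled residual, and define λ̂_b^(s) = λ_b^(s) − (Ã^(s))ᵀ r. Then for each s, the Fredholm (self-equilibrium) condition (R_b^(s))ᵀ (λ̂_b^(s) + b^(s)) = 0 holds if and only if the balancing condition (Ã^(s) R_b^(s))ᵀ r = 0 holds. -/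
open Matrix

/-- Assume each local Schur complement `S^(s)` is symmetric with
`S^(s) R_b^(s) = 0`. For a global interface vector `u_b`, with
`λ_b^(s) = S^(s) (A^(s))ᵀ u_b − b^(s)`, `r = Σ_s A^(s) λ_b^(s)` and
`λ̂_b^(s) = λ_b^(s) − (Ã^(s))ᵀ r`, the Fredholm condition
`(R_b^(s))ᵀ (λ̂_b^(s) + b^(s)) = 0` holds iff the balancing condition
`(Ã^(s) R_b^(s))ᵀ r = 0` holds. -/
theorem fredholm_iff_balancing
    {nsd nΓ : ℕ} {nb nr : Fin nsd → ℕ}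
    (S : ∀ s, Matrix (Fin (nb s)) (Fin (nb s)) ℝ)
    (hSsym : ∀ s, (S s)ᵀ = S s)
    (Rb : ∀ s, Matrix (Fin (nb s)) (Fin (nr s)) ℝ)
    (hSR : ∀ s, S s * Rb s = 0)
    (b : ∀ s, Fin (nb s) → ℝ)
    (A : ∀ s, Matrix (Fin nΓ) (Fin (nb s)) ℝ)
    (Atil : ∀ s, Matrix (Fin nΓ) (Fin (nb s)) ℝ)
    (ub : Fin nΓ → ℝ)
    (lamb : ∀ s, Fin (nb s) → ℝ)
    (hlamb : ∀ s, lamb s = (S s).mulVec ((A s)ᵀ.mulVec ub) - b s)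
    (r : Fin nΓ → ℝ) (hr : r = ∑ s, (A s).mulVec (lamb s))
    (lamhat : ∀ s, Fin (nb s) → ℝ)
    (hlamhat : ∀ s, lamhat s = lamb s - (Atil s)ᵀ.mulVec r) :
    ∀ s, (Rb s)ᵀ.mulVec (lamhat s + b s) = 0 ↔
      (Atil s * Rb s)ᵀ.mulVec r = 0 := by
  intro s
  have hRS : (Rb s)ᵀ * S s = 0 := by
    rw [← hSsym s, ← transpose_mul, hSR s, transpose_zero]
  have key : (Rb s)ᵀ.mulVec (lamhat s + b s) = -(Atil s * Rb s)ᵀ.mulVec r := by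
    have h : lamhat s + b s = (S s).mulVec ((A s)ᵀ.mulVec ub) - (Atil s)ᵀ.mulVec r := by
      rw [hlamhat s, hlamb s]
      abel
    rw [h, mulVec_sub, mulVec_mulVec _ (Rb s)ᵀ (S s), hRS, zero_mulVec, zero_sub,
      transpose_mul, mulVec_mulVec]
  rw [key, neg_eq_zero]
end
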